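/- For every nonnegative integer M, the identity 1/(zq;q)_M = Σ_{m=0}^{M} q^{m²} z^m / (zq;q)_m · [M choose m]_q holds as an identity of rational functions in the indeterminates q and z. -/

import Mathlib

noncomputable section

/-- The field of rational functions `ℚ(q, z)`; the variable indexed by `none` plays the
role of `q` and the variable indexed by `some 0` plays the role of `z`. -/
abbrev FF := FractionRing (MvPolynomial (Option (Fin 1)) ℚ)

/-- The indeterminate `q`. -/
def qv : FF :=
  algebraMap (MvPolynomial (Option (Fin 1)) ℚ) FF (MvPolynomial.X (none : Option (Fin 1)))

/-- The indeterminate `z`. -/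
def zv : FF :=
  algebraMap (MvPolynomial (Option (Fin 1)) ℚ) FF (MvPolynomial.X (some 0))

/-- The q-Pochhammer symbol `(z; q)_M = ∏_{k=1}^M (1 - z q^{k-1})`. -/
def qPoch {F : Type*} [CommRing F] (q z : F) (M : ℕ) : F :=
  ∏ k ∈ Finset.range M, (1 - z * q ^ k)

/-- The q-binomial `[x choose y]_q = (q;q)_x / ((q;q)_y (q;q)_{x-y})` for `0 ≤ y ≤ x`,
and `0` otherwise. -/
def qBinom {F : Type*} [Field F] (q : F) (x y : ℤ) : F :=
  if 0 ≤ y ∧ y ≤ x then qPoch q q x.toNat / (qPoch q q y.toNat * qPoch q q (x - y).toNat)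
  else 0

theorem qPoch_zero {F : Type*} [CommRing F] (q z : F) : qPoch q z 0 = 1 := by
  simp [qPoch]

theorem qPoch_succ {F : Type*} [CommRing F] (q z : F) (M : ℕ) :
    qPoch q z (M + 1) = qPoch q z M * (1 - z * q ^ M) :=
  Finset.prod_range_succ _ _

theorem qPoch_succ' {F : Type*} [CommRing F] (q z : F) (M : ℕ) :
    qPoch q z (M + 1) = (1 - z) * qPoch q (z * q) M := by
  simp only [qPoch, Finset.prod_range_succ', pow_zero, mul_one, pow_succ']
  rw [mul_comm]
  simp only [mul_assoc]

theorem qPoch_ne_zero {F : Type*} [Field F] {q z : F} (h : ∀ k : ℕ, 1 - z * q ^ k ≠ 0) (M : ℕ) :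
    qPoch q z M ≠ 0 :=
  Finset.prod_ne_zero_iff.2 fun k _ => h k

theorem qBinom_add {F : Type*} [Field F] (q : F) (m d : ℕ) :
    qBinom q ((m + d : ℕ) : ℤ) (m : ℤ) = qPoch q q (m + d) / (qPoch q q m * qPoch q q d) := by
  rw [qBinom, if_pos (by omega), Int.toNat_natCast, Int.toNat_natCast,
    show (((m + d : ℕ) : ℤ) - (m : ℤ)).toNat = d by omega]

theorem qBinom_of_lt {F : Type*} [Field F] (q : F) {M m : ℕ} (h : M < m) :
    qBinom q (M : ℤ) (m : ℤ) = 0 :=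
  if_neg (by omega)

theorem qBinom_zero_right {F : Type*} [Field F] {q : F} (hq : ∀ k : ℕ, 1 - q * q ^ k ≠ 0) (M : ℕ) :
    qBinom q (M : ℤ) ((0 : ℕ) : ℤ) = 1 := by
  have h := qBinom_add q 0 M
  rwa [zero_add, qPoch_zero, one_mul, div_self (qPoch_ne_zero hq M)] at h

theorem qBinom_self {F : Type*} [Field F] {q : F} (hq : ∀ k : ℕ, 1 - q * q ^ k ≠ 0) (M : ℕ) :
    qBinom q (M : ℤ) (M : ℤ) = 1 := by
  have h := qBinom_add q M 0
  rwa [add_zero, qPoch_zero, mul_one, div_self (qPoch_ne_zero hq M)] at h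

/-- The `q`-Pascal rule. -/
theorem qBinom_succ_succ {F : Type*} [Field F] {q : F} (hq : ∀ k : ℕ, 1 - q * q ^ k ≠ 0)
    (M m : ℕ) :
    qBinom q ((M + 1 : ℕ) : ℤ) ((m + 1 : ℕ) : ℤ) =
      qBinom q (M : ℤ) (m : ℤ) + q ^ (m + 1) * qBinom q (M : ℤ) ((m + 1 : ℕ) : ℤ) := by
  rcases lt_trichotomy M m with h | rfl | h
  · rw [qBinom_of_lt q h, qBinom_of_lt q (Nat.succ_lt_succ h), qBinom_of_lt q (Nat.lt_succ_of_lt h)]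
    ring
  · rw [qBinom_self hq, qBinom_self hq, qBinom_of_lt q (Nat.lt_succ_self M)]
    ring
  · obtain ⟨d, rfl⟩ := Nat.exists_eq_add_of_le (Nat.succ_le_of_lt h)
    rw [show m.succ + d + 1 = m + 1 + (d + 1) by omega, qBinom_add,
      show m.succ + d = m + 1 + d by omega, qBinom_add,
      show m + 1 + d = m + (d + 1) by omega, qBinom_add,
      show m + 1 + (d + 1) = m + (d + 1) + 1 by omega,
      qPoch_succ q q (m + (d + 1)), qPoch_succ q q m, qPoch_succ q q d]
    have hm := qPoch_ne_zero hq m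
    have hd := qPoch_ne_zero hq d
    have hm' := hq m
    have hd' := hq d
    field_simp
    ring

/-- Summing the `q`-Pascal rule against an arbitrary weight. -/
theorem sum_mul_qBinom_succ {F : Type*} [Field F] {q : F} (hq : ∀ k : ℕ, 1 - q * q ^ k ≠ 0)
    (f : ℕ → F) (M : ℕ) :
    ∑ m ∈ Finset.range (M + 2), f m * qBinom q ((M + 1 : ℕ) : ℤ) (m : ℤ) =
      ∑ m ∈ Finset.range (M + 1), (f (m + 1) + f m * q ^ m) * qBinom q (M : ℤ) (m : ℤ) := by
  have key : ∑ m ∈ Finset.range (M + 1), f m * q ^ m * qBinom q (M : ℤ) (m : ℤ) =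
      ∑ m ∈ Finset.range (M + 1),
        f (m + 1) * q ^ (m + 1) * qBinom q (M : ℤ) ((m + 1 : ℕ) : ℤ) + f 0 := by
    have h := Finset.sum_range_succ (fun m : ℕ => f m * q ^ m * qBinom q (M : ℤ) (m : ℤ)) (M + 1)
    rw [qBinom_of_lt q (Nat.lt_succ_self M), mul_zero, add_zero] at h
    rw [← h, Finset.sum_range_succ', qBinom_zero_right hq, pow_zero, mul_one, mul_one]
  rw [Finset.sum_range_succ', qBinom_zero_right hq, mul_one]
  simp only [add_mul, Finset.sum_add_distrib]
  rw [key, ← add_assoc, ← Finset.sum_add_distrib]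
  congr 1
  refine Finset.sum_congr rfl fun m _ => ?_
  rw [qBinom_succ_succ hq]
  ring

/-- Cauchy's finite Durfee square identity over a field in which no denominator vanishes. -/
theorem inv_qPoch_eq_sum {F : Type*} [Field F] {q : F} (hq : ∀ k : ℕ, 1 - q * q ^ k ≠ 0) (M : ℕ) :
    ∀ z : F, (∀ k : ℕ, 1 - z * q * q ^ k ≠ 0) →
      (qPoch q (z * q) M)⁻¹ =
        ∑ m ∈ Finset.range (M + 1),
          q ^ (m ^ 2) * z ^ m / qPoch q (z * q) m * qBinom q (M : ℤ) (m : ℤ) := by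
  induction M with
  | zero =>
    intro z _
    rw [Finset.sum_range_one, qBinom_self hq]
    simp [qPoch_zero]
  | succ M ih =>
    intro z hz
    have hz' : ∀ k : ℕ, 1 - z * q * q * q ^ k ≠ 0 := fun k => by
      simpa only [pow_succ', mul_assoc] using hz (k + 1)
    rw [sum_mul_qBinom_succ hq (fun m => q ^ (m ^ 2) * z ^ m / qPoch q (z * q) m), qPoch_succ',
      mul_inv, ih (z * q) hz', Finset.mul_sum]
    refine Finset.sum_congr rfl fun m _ => ?_
    rw [← mul_assoc]
    congr 1
    have hm := hz m
    have hPQ : qPoch q (z * q) m * (1 - z * q * q ^ m) = (1 - z * q) * qPoch q (z * q * q) m := by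
      rw [← qPoch_succ, qPoch_succ']
    have hinv : (qPoch q (z * q) m)⁻¹ =
        (1 - z * q * q ^ m) * ((1 - z * q)⁻¹ * (qPoch q (z * q * q) m)⁻¹) := by
      rw [← mul_inv, ← hPQ]
      field_simp
    simp only [div_eq_mul_inv]
    rw [qPoch_succ', mul_inv, hinv]
    ring

theorem one_sub_algebraMap_ne_zero {p : MvPolynomial (Option (Fin 1)) ℚ}
    (hp : MvPolynomial.constantCoeff p = 0) :
    1 - algebraMap (MvPolynomial (Option (Fin 1)) ℚ) FF p ≠ 0 := by
  rw [← map_one (algebraMap (MvPolynomial (Option (Fin 1)) ℚ) FF), ← map_sub]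
  refine (map_ne_zero_iff _ (IsFractionRing.injective _ FF)).2 fun h => ?_
  simpa [hp] using congrArg MvPolynomial.constantCoeff h

/-- Cauchy's finite Durfee square identity.  For every `M ∈ ℤ≥0`,
`1/(zq;q)_M = Σ_{m=0}^{M} q^{m²} z^m / (zq;q)_m ⬝ [M choose m]_q`
as rational functions in `q` and `z`. -/
theorem cauchy_durfee_square (M : ℕ) :
    (qPoch qv (zv * qv) M)⁻¹ =
      ∑ m ∈ Finset.range (M + 1),
        qv ^ (m ^ 2) * zv ^ m / qPoch qv (zv * qv) m * qBinom qv (M : ℤ) (m : ℤ) := by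
  refine inv_qPoch_eq_sum (fun k => ?_) M zv fun k => ?_
  · rw [qv, ← map_pow, ← map_mul]
    exact one_sub_algebraMap_ne_zero (by simp)
  · rw [qv, zv, ← map_pow, ← map_mul, ← map_mul]
    exact one_sub_algebraMap_ne_zero (by simp)
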